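/- Let λ_1, ..., λ_n be vectors in a rational inner product space with (λ_i | λ_j) = (1/2)δ_{ij}, let P = ⊕_{i=1}^n ℤλ_i and 2ρ̄ = λ_1 + ⋯ + λ_n. Then as formal power series in q with coefficients in the group ring of P, ∏_{i=1}^n ∏_{j=1}^∞ (1-q^j)(1 + e^{λ_i} q^j)(1 + e^{-λ_i} q^{j-1}) = ∑_{λ ∈ P} e^{λ} q^{(λ | λ + 2ρ̄)}. -/

import Mathlib

open scoped RealInnerProductSpace

section JacobiAux
open Filter Topology

/-- The triangular number `m(m+1)/2`. -/
def jT (m : ℤ) : ℕ := (m * (m + 1) / 2).toNat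

lemma jT_spec (m : ℤ) : (jT m : ℤ) * 2 = m * (m + 1) := by
  have h1 : 2 ∣ m * (m + 1) := (Int.even_mul_succ_self m).two_dvd
  have h2 : 0 ≤ m * (m + 1) := by
    rcases le_or_gt 0 m with h | h
    · positivity
    · nlinarith
  unfold jT
  rw [Int.toNat_of_nonneg (by omega)]
  omega

lemma jT_nat_succ (n : ℕ) : jT ((n + 1 : ℕ) : ℤ) = jT n + (n + 1) := by
  have h1 := jT_spec ((n + 1 : ℕ) : ℤ)
  have h2 := jT_spec n
  push_cast at h1 h2
  zify
  linarith

lemma jT_neg (n : ℕ) : jT (-(n + 1 : ℤ)) = jT n := by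
  unfold jT
  congr 2
  ring

lemma jsummable_nat (a r : ℝ) (hr0 : 0 ≤ r) (hr : r < 1) :
    Summable fun n : ℕ => a ^ n * r ^ jT n := by
  have hlim : Tendsto (fun n : ℕ => |a| * r ^ (n + 1)) atTop (𝓝 0) := by
    have := ((tendsto_pow_atTop_nhds_zero_of_lt_one hr0 hr).comp (tendsto_add_atTop_nat 1)).const_mul |a|
    simpa using this
  apply summable_of_ratio_norm_eventually_le (r := 1 / 2) (by norm_num)
  filter_upwards [hlim.eventually (gt_mem_nhds (show (0 : ℝ) < 1 / 2 by norm_num))] with n hn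
  rw [jT_nat_succ]
  simp only [norm_mul, norm_pow, Real.norm_eq_abs, abs_of_nonneg hr0]
  calc |a| ^ (n + 1) * r ^ (jT n + (n + 1)) = (|a| * r ^ (n + 1)) * (|a| ^ n * r ^ jT n) := by ring
    _ ≤ 1 / 2 * (|a| ^ n * r ^ jT n) := by gcongr

lemma jsummable (q u : ℂ) (hq : ‖q‖ < 1) :
    Summable fun m : ℤ => ‖u ^ m * q ^ jT m‖ := by
  apply Summable.of_nat_of_neg_add_one
  · simpa using jsummable_nat ‖u‖ ‖q‖ (norm_nonneg _) hq
  · refine ((jsummable_nat ‖u‖⁻¹ ‖q‖ (norm_nonneg _) hq).mul_left ‖u‖⁻¹).congr fun n => ?_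
    rw [jT_neg, norm_mul, norm_zpow, norm_pow, zpow_neg, ← inv_zpow]
    rw [show ((n : ℤ) + 1) = ((n + 1 : ℕ) : ℤ) by push_cast; rfl, zpow_natCast]
    ring

/-- The finite Pochhammer symbol `(q;q)_n`. -/
noncomputable def jQ (q : ℂ) (n : ℕ) : ℂ := ∏ k ∈ Finset.range n, (1 - q ^ (k + 1))

/-- `1/(q;q)_k`, extended by zero to negative `k`. -/
noncomputable def jP (q : ℂ) (k : ℤ) : ℂ := if 0 ≤ k then (jQ q k.toNat)⁻¹ else 0

lemma one_sub_pow_ne (q : ℂ) (hq : ‖q‖ < 1) (k : ℕ) : 1 - q ^ (k + 1) ≠ 0 := by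
  intro h
  have h1 : ‖q ^ (k + 1)‖ < 1 := by
    rw [norm_pow]; exact pow_lt_one₀ (norm_nonneg _) hq (by omega)
  rw [← sub_eq_zero.mp h] at h1
  simp at h1

lemma jQ_ne (q : ℂ) (hq : ‖q‖ < 1) (n : ℕ) : jQ q n ≠ 0 :=
  Finset.prod_ne_zero_iff.mpr fun k _ => one_sub_pow_ne q hq k

lemma jP_rec (q : ℂ) (hq : ‖q‖ < 1) (k : ℤ) : jP q (k - 1) = (1 - q ^ k) * jP q k := by
  unfold jP
  rcases lt_trichotomy k 0 with h | h | h
  · rw [if_neg (by omega), if_neg (by omega)]; simp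
  · subst h; simp
  · obtain ⟨n, rfl⟩ : ∃ n : ℕ, k = ((n + 1 : ℕ) : ℤ) := ⟨(k - 1).toNat, by omega⟩
    rw [if_pos (by omega), if_pos (by omega)]
    rw [show (((n + 1 : ℕ) : ℤ) - 1).toNat = n by omega, Int.toNat_natCast, zpow_natCast]
    unfold jQ
    rw [Finset.prod_range_succ]
    have := one_sub_pow_ne q hq n
    rw [mul_inv, mul_left_comm, mul_inv_cancel₀ this, mul_one]

/-- Terms of the finite form of the triple product. -/
noncomputable def jb (q u : ℂ) (N : ℕ) (m : ℤ) : ℂ :=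
  jQ q (2 * N) * jP q (N - m) * jP q (N + m) * (u ^ m * q ^ jT m)

lemma jb_rec (q u : ℂ) (hq : ‖q‖ < 1) (hq0 : q ≠ 0) (hu : u ≠ 0) (N : ℕ) (m : ℤ) :
    jb q u (N + 1) m = (1 + q ^ (2 * N + 1)) * jb q u N m + u * q ^ (N + 1) * jb q u N (m - 1)
      + u⁻¹ * q ^ N * jb q u N (m + 1) := by
  have e0 := jP_rec q hq (N + 1 - m)
  have e1 := jP_rec q hq (N + 1 + m)
  have e2 := jP_rec q hq (N - m)
  have e3 := jP_rec q hq (N + m)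
  rw [show (N + 1 - m - 1 : ℤ) = N - m by ring] at e0
  rw [show (N + 1 + m - 1 : ℤ) = N + m by ring] at e1
  have hA : q ^ (N - m : ℤ) = q ^ (N + 1 - m : ℤ) / q := by
    rw [div_eq_mul_inv, ← zpow_sub_one₀ hq0]; congr 1; ring
  have hB : q ^ (N + m : ℤ) = q ^ (N + 1 + m : ℤ) / q := by
    rw [div_eq_mul_inv, ← zpow_sub_one₀ hq0]; congr 1; ring
  have hAB : q ^ (2 * N + 2) = q ^ (N + 1 - m : ℤ) * q ^ (N + 1 + m : ℤ) := by
    rw [← zpow_add₀ hq0, ← zpow_natCast]; congr 1; push_cast; ring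
  have hAB' : q ^ (2 * N + 1) = q ^ (N + 1 - m : ℤ) * q ^ (N + 1 + m : ℤ) / q := by
    rw [← hAB, eq_div_iff hq0]; ring
  have t1 : u * q ^ (N + 1) * (u ^ (m - 1) * q ^ jT (m - 1))
      = q ^ (N + 1 - m : ℤ) * (u ^ m * q ^ jT m) := by
    have h1 := jT_spec m
    have h2 := jT_spec (m - 1)
    have h3 : q ^ (N + 1) * q ^ jT (m - 1) = q ^ (N + 1 - m : ℤ) * q ^ jT m := by
      rw [← zpow_natCast, ← zpow_natCast, ← zpow_natCast, ← zpow_add₀ hq0, ← zpow_add₀ hq0]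
      congr 1; push_cast; linarith
    rw [zpow_sub_one₀ hu]
    calc _ = (u * u⁻¹) * u ^ m * (q ^ (N + 1) * q ^ jT (m - 1)) := by ring
      _ = _ := by rw [h3, mul_inv_cancel₀ hu]; ring
  have t2 : u⁻¹ * q ^ N * (u ^ (m + 1) * q ^ jT (m + 1))
      = q ^ (N + 1 + m : ℤ) * (u ^ m * q ^ jT m) := by
    have h1 := jT_spec m
    have h2 := jT_spec (m + 1)
    have h3 : q ^ N * q ^ jT (m + 1) = q ^ (N + 1 + m : ℤ) * q ^ jT m := by
      rw [← zpow_natCast, ← zpow_natCast, ← zpow_natCast, ← zpow_add₀ hq0, ← zpow_add₀ hq0]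
      congr 1; linarith
    rw [zpow_add_one₀ hu]
    calc _ = (u * u⁻¹) * u ^ m * (q ^ N * q ^ jT (m + 1)) := by ring
      _ = _ := by rw [h3, mul_inv_cancel₀ hu]; ring
  have hQ : jQ q (2 * (N + 1)) = jQ q (2 * N) * (1 - q ^ (2 * N + 1)) * (1 - q ^ (2 * N + 2)) := by
    unfold jQ
    rw [show 2 * (N + 1) = 2 * N + 1 + 1 by ring, Finset.prod_range_succ, Finset.prod_range_succ]
  have s1 : u * q ^ (N + 1) * jb q u N (m - 1) = jQ q (2 * N) * jP q (N + 1 - m) * jP q (N + m - 1)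
      * (q ^ (N + 1 - m : ℤ) * (u ^ m * q ^ jT m)) := by
    rw [← t1]; unfold jb
    rw [show (N - (m - 1) : ℤ) = N + 1 - m by ring, show (N + (m - 1) : ℤ) = N + m - 1 by ring]
    ring
  have s2 : u⁻¹ * q ^ N * jb q u N (m + 1) = jQ q (2 * N) * jP q (N - m - 1) * jP q (N + 1 + m)
      * (q ^ (N + 1 + m : ℤ) * (u ^ m * q ^ jT m)) := by
    rw [← t2]; unfold jb
    rw [show (N - (m + 1) : ℤ) = N - m - 1 by ring, show (N + (m + 1) : ℤ) = N + 1 + m by ring]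
    ring
  rw [s1, s2, e2, e3]
  unfold jb
  rw [hQ, e0, e1, hA, hB, hAB, hAB']
  push_cast
  generalize q ^ (N + 1 - m : ℤ) = A
  generalize q ^ (N + 1 + m : ℤ) = B
  generalize u ^ m * q ^ jT m = Z
  field_simp
  ring

lemma jb_hasSum (q u : ℂ) (hq : ‖q‖ < 1) (hq0 : q ≠ 0) (hu : u ≠ 0) (N : ℕ) :
    HasSum (jb q u N) (∏ j ∈ Finset.range N, ((1 + u * q ^ (j + 1)) * (1 + u⁻¹ * q ^ j))) := by
  induction N with
  | zero =>
    have h0 : jb q u 0 0 = 1 := by simp [jb, jQ, jP, jT]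
    rw [Finset.prod_range_zero, ← h0]
    apply hasSum_single
    intro m hm
    unfold jb jP
    rcases lt_or_gt_of_ne hm with h | h
    · have h' : ¬ (0 : ℤ) ≤ ((0 : ℕ) : ℤ) + m := by omega
      simp only [if_neg h', mul_zero, zero_mul]
    · have h' : ¬ (0 : ℤ) ≤ ((0 : ℕ) : ℤ) - m := by omega
      simp only [if_neg h', mul_zero, zero_mul]
  | succ N ih =>
    have h1 := (Equiv.subRight (1 : ℤ)).hasSum_iff.mpr ih
    have h2 := (Equiv.addRight (1 : ℤ)).hasSum_iff.mpr ih
    have := ((ih.mul_left (1 + q ^ (2 * N + 1))).add (h1.mul_left (u * q ^ (N + 1)))).add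
      (h2.mul_left (u⁻¹ * q ^ N))
    rw [Finset.prod_range_succ]
    convert this using 1
    · rfl
    · funext m; exact jb_rec q u hq hq0 hu N m
    · generalize ∏ j ∈ Finset.range N, ((1 + u * q ^ (j + 1)) * (1 + u⁻¹ * q ^ j)) = S
      field_simp
      ring

lemma summable_geom_norm (q c : ℂ) (hq : ‖q‖ < 1) : Summable fun j : ℕ => ‖c * q ^ j‖ := by
  simp only [norm_mul, norm_pow]
  exact (summable_geometric_of_lt_one (norm_nonneg _) hq).mul_left _

lemma jQ_multipliable (q : ℂ) (hq : ‖q‖ < 1) : Multipliable fun j : ℕ => (1 - q ^ (j + 1)) := by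
  have := multipliable_one_add_of_summable (summable_geom_norm q (-q) hq)
  refine this.congr fun j => ?_
  ring

lemma jQ_tendsto (q : ℂ) (hq : ‖q‖ < 1) :
    Tendsto (jQ q) atTop (𝓝 (∏' j : ℕ, (1 - q ^ (j + 1)))) :=
  (jQ_multipliable q hq).hasProd.tendsto_prod_nat

lemma jQ_tprod_ne (q : ℂ) (hq : ‖q‖ < 1) : (∏' j : ℕ, (1 - q ^ (j + 1))) ≠ 0 := by
  have := tprod_one_add_ne_zero_of_summable (f := fun j : ℕ => -q * q ^ j) (fun j => by
    have := one_sub_pow_ne q hq j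
    rw [pow_succ'] at this
    simpa [sub_eq_add_neg] using this) (summable_geom_norm q (-q) hq)
  convert this using 3 with j
  ring

lemma jP_tendsto (q : ℂ) (hq : ‖q‖ < 1) :
    Tendsto (jP q) atTop (𝓝 (∏' j : ℕ, (1 - q ^ (j + 1)))⁻¹) := by
  have h1 : Tendsto (fun k : ℤ => (jQ q k.toNat)⁻¹) atTop (𝓝 (∏' j : ℕ, (1 - q ^ (j + 1)))⁻¹) := by
    refine ((jQ_tendsto q hq).inv₀ (jQ_tprod_ne q hq)).comp ?_
    exact tendsto_atTop.mpr fun b => by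
      filter_upwards [eventually_ge_atTop (b : ℤ)] with k hk
      omega
  refine h1.congr' ?_
  filter_upwards [eventually_ge_atTop (0 : ℤ)] with k hk
  simp [jP, hk]

lemma jQ_bdd (q : ℂ) (hq : ‖q‖ < 1) : ∃ C, 0 ≤ C ∧ ∀ n, ‖jQ q n‖ ≤ C := by
  obtain ⟨C, hC⟩ := (Metric.isBounded_range_of_tendsto _ (jQ_tendsto q hq)).exists_norm_le
  exact ⟨C, (norm_nonneg _).trans (hC _ ⟨0, rfl⟩), fun n => hC _ ⟨n, rfl⟩⟩

lemma jP_bdd (q : ℂ) (hq : ‖q‖ < 1) : ∃ C, 0 ≤ C ∧ ∀ n, ‖jP q n‖ ≤ C := by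
  obtain ⟨C, hC⟩ := (Metric.isBounded_range_of_tendsto _
    ((jQ_tendsto q hq).inv₀ (jQ_tprod_ne q hq))).exists_norm_le
  have h0 : 0 ≤ C := (norm_nonneg _).trans (hC _ ⟨0, rfl⟩)
  refine ⟨C, h0, fun n => ?_⟩
  unfold jP
  split_ifs
  · exact hC _ ⟨_, rfl⟩
  · simpa using h0

lemma jprod_tendsto (q u : ℂ) (hq : ‖q‖ < 1) (hq0 : q ≠ 0) (hu : u ≠ 0) :
    Tendsto (fun N => ∏ j ∈ Finset.range N, ((1 + u * q ^ (j + 1)) * (1 + u⁻¹ * q ^ j))) atTop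
      (𝓝 ((∏' j : ℕ, (1 - q ^ (j + 1)))⁻¹ * ∑' m : ℤ, u ^ m * q ^ jT m)) := by
  obtain ⟨C, hC0, hC⟩ := jQ_bdd q hq
  obtain ⟨D, hD0, hD⟩ := jP_bdd q hq
  have hne := jQ_tprod_ne q hq
  have key := tendsto_tsum_of_dominated_convergence (𝓕 := atTop) (f := jb q u)
    (g := fun m => (∏' j : ℕ, (1 - q ^ (j + 1)))⁻¹ * (u ^ m * q ^ jT m))
    (bound := fun m => C * D * D * ‖u ^ m * q ^ jT m‖) ((jsummable q u hq).mul_left _)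
    (fun m => by
      have h1 : Tendsto (fun N : ℕ => jQ q (2 * N)) atTop (𝓝 (∏' j : ℕ, (1 - q ^ (j + 1)))) :=
        (jQ_tendsto q hq).comp (tendsto_id.const_mul_atTop' (by norm_num))
      have h2 : Tendsto (fun N : ℕ => jP q (N - m)) atTop (𝓝 (∏' j : ℕ, (1 - q ^ (j + 1)))⁻¹) :=
        (jP_tendsto q hq).comp (tendsto_atTop_add_const_right _ (-m) tendsto_natCast_atTop_atTop)
      have h3 : Tendsto (fun N : ℕ => jP q (N + m)) atTop (𝓝 (∏' j : ℕ, (1 - q ^ (j + 1)))⁻¹) :=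
        (jP_tendsto q hq).comp (tendsto_atTop_add_const_right _ m tendsto_natCast_atTop_atTop)
      have := ((h1.mul h2).mul h3).mul_const (u ^ m * q ^ jT m)
      rwa [mul_inv_cancel₀ hne, one_mul] at this)
    (Eventually.of_forall fun N m => by
      unfold jb
      rw [norm_mul, norm_mul, norm_mul]
      have := hC (2 * N)
      have := hD (N - m)
      have := hD (N + m)
      gcongr)
  rw [tsum_mul_left] at key
  exact key.congr fun N => (jb_hasSum q u hq hq0 hu N).tsum_eq

lemma jacobi_one (q u : ℂ) (hq : ‖q‖ < 1) (hu : u ≠ 0) :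
    ∏' j : ℕ, ((1 - q ^ (j + 1)) * (1 + u * q ^ (j + 1)) * (1 + u⁻¹ * q ^ j))
      = ∑' m : ℤ, u ^ m * q ^ jT m := by
  by_cases hq0 : q = 0
  · subst hq0
    rw [tprod_eq_mulSingle 0 (fun j hj => by simp [hj])]
    rw [tsum_eq_sum (s := {0, -1})]
    · simp [jT]
    · intro m hm
      have h1 := jT_spec m
      have : jT m ≠ 0 := by
        intro h
        rw [h] at h1
        have h2 : m * (m + 1) = 0 := by simpa using h1.symm
        rcases mul_eq_zero.mp h2 with h | h
        · simp [h] at hm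
        · have : m = -1 := by omega
          simp [this] at hm
      simp [this]
  · have m1 := jQ_multipliable q hq
    have m2 : Multipliable fun j : ℕ => (1 + u * q ^ (j + 1)) := by
      refine (multipliable_one_add_of_summable (summable_geom_norm q (u * q) hq)).congr fun j => ?_
      ring
    have m3 : Multipliable fun j : ℕ => (1 + u⁻¹ * q ^ j) :=
      multipliable_one_add_of_summable (summable_geom_norm q u⁻¹ hq)
    have L := ((m1.mul m2).mul m3).hasProd.tendsto_prod_nat
    have R := (jQ_tendsto q hq).mul (jprod_tendsto q u hq hq0 hu)
    rw [mul_inv_cancel_left₀ (jQ_tprod_ne q hq)] at R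
    refine tendsto_nhds_unique L (R.congr fun N => ?_)
    unfold jQ
    rw [← Finset.prod_mul_distrib]
    exact Finset.prod_congr rfl fun j _ => by ring

lemma prod_tsum_pi (n : ℕ) (f : Fin n → ℤ → ℂ) (hf : ∀ i, Summable fun m => ‖f i m‖) :
    (Summable fun m : Fin n → ℤ => ‖∏ i, f i (m i)‖) ∧
      ∏ i, ∑' m, f i m = ∑' m : Fin n → ℤ, ∏ i, f i (m i) := by
  induction n with
  | zero =>
    refine ⟨(hasSum_fintype _).summable, ?_⟩
    rw [tsum_fintype]; simp
  | succ n ih =>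
    obtain ⟨h1, h2⟩ := ih (fun i => f i.succ) (fun i => hf _)
    let e : ℤ × (Fin n → ℤ) ≃ (Fin (n + 1) → ℤ) := Fin.consEquiv (fun _ => ℤ)
    have he : ∀ p, ∏ i, f i (e p i) = f 0 p.1 * ∏ i : Fin n, f i.succ (p.2 i) := by
      intro p
      rw [Fin.prod_univ_succ]
      simp [e, Fin.consEquiv]
    constructor
    · rw [← e.summable_iff]
      refine (Summable.mul_norm (hf 0) h1).congr fun p => ?_
      simp only [Function.comp_apply]
      rw [he]
    · rw [← e.tsum_eq, Fin.prod_univ_succ, h2, tsum_mul_tsum_of_summable_norm (hf 0) h1]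
      exact tsum_congr fun p => (he p).symm

lemma inner_eq_jT {V : Type*} [NormedAddCommGroup V]
    [InnerProductSpace ℝ V] (n : ℕ) (lam : Fin n → V)
    (hlam : ∀ i j, ⟪lam i, lam j⟫ = if i = j then (1 / 2 : ℝ) else 0) (m : Fin n → ℤ) :
    ⟪∑ i, (m i : ℝ) • lam i, (∑ i, (m i : ℝ) • lam i) + ∑ i, lam i⟫
      = ((∑ i, jT (m i) : ℕ) : ℝ) := by
  rw [← Finset.sum_add_distrib, sum_inner]
  push_cast
  refine Finset.sum_congr rfl fun i _ => ?_
  rw [inner_sum]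
  simp only [inner_add_right, real_inner_smul_left, real_inner_smul_right, hlam]
  have h : (jT (m i) : ℝ) * 2 = m i * (m i + 1) := by exact_mod_cast jT_spec (m i)
  rw [Finset.sum_eq_single i]
  · simp; linarith
  · intro j _ hj
    simp [hj.symm]
  · simp

end JacobiAux



/-- Multi-variable Jacobi triple product: for pairwise orthogonal vectors `λ₁, …, λₙ` in an
inner product space with `(λ_i | λ_j) = (1/2)δ_{ij}`, `P = ⊕ ℤλ_i` and `2ρ̄ = λ₁ + ⋯ + λₙ`,
`∏_{i=1}^n ∏_{j=1}^∞ (1-q^j)(1 + e^{λ_i} q^j)(1 + e^{-λ_i} q^{j-1})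
  = ∑_{λ ∈ P} e^λ q^{(λ | λ + 2ρ̄)}`,
where `e^{λ_i}` is evaluated at the nonzero complex number `u i` (so that `e^λ = ∏ u_i^{m_i}`
for `λ = ∑ m_i λ_i`) and `‖q‖ < 1` ensures convergence. -/
theorem multivariable_jacobi_triple_product {V : Type*} [NormedAddCommGroup V]
    [InnerProductSpace ℝ V] (n : ℕ) (lam : Fin n → V)
    (hlam : ∀ i j, ⟪lam i, lam j⟫ = if i = j then (1 / 2 : ℝ) else 0)
    (q : ℂ) (hq : ‖q‖ < 1) (u : Fin n → ℂ) (hu : ∀ i, u i ≠ 0) :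
    ∏ i : Fin n, ∏' j : ℕ,
        ((1 - q ^ (j + 1)) * (1 + u i * q ^ (j + 1)) * (1 + (u i)⁻¹ * q ^ j))
      = ∑' m : Fin n → ℤ, (∏ i, u i ^ m i) *
          q ^ ((⟪∑ i, (m i : ℝ) • lam i, (∑ i, (m i : ℝ) • lam i) + ∑ i, lam i⟫ : ℝ) : ℂ) := by
  have h : ∀ m : Fin n → ℤ, (∏ i, u i ^ m i) *
      q ^ ((⟪∑ i, (m i : ℝ) • lam i, (∑ i, (m i : ℝ) • lam i) + ∑ i, lam i⟫ : ℝ) : ℂ)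
      = ∏ i, (u i ^ m i * q ^ jT (m i)) := by
    intro m
    rw [inner_eq_jT n lam hlam m, Complex.ofReal_natCast, Complex.cpow_natCast,
      Finset.prod_mul_distrib, Finset.prod_pow_eq_pow_sum]
  rw [tsum_congr h, ← (prod_tsum_pi n (fun i m => u i ^ m * q ^ jT m)
    (fun i => jsummable q (u i) hq)).2]
  exact Finset.prod_congr rfl fun i _ => jacobi_one q (u i) hq (hu i)
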